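/- Let s > 1, let y₁, …, y_n > 0 and a₁, …, a_n ∈ ℝ, and let u ∈ C^∞(I, H^s_+(𝕋)) be a solution of u̇ = X_Ĵ(u) on a time interval I containing 0, where Ĵ = Σ_k a_k J^{y_k}. Let Û(t), V̂(t) ∈ ℒ(L²_+(𝕋)) solve dÛ/dt = B̂_{u(t)} Û, dV̂/dt = Ĉ_{u(t)} V̂, Û(0) = V̂(0) = I, where B̂_u = Σ_k a_k B_u^{y_k} and Ĉ_u = Σ_k a_k C_u^{y_k}. Then Û(t) and V̂(t) are unitary, and H_{u(t)} = Û(t) H_{u(0)} Û(t)* and K_{u(t)} = V̂(t) K_{u(0)} V̂(t)*. -/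

import Mathlib

open scoped BigOperators ComplexConjugate

noncomputable section

/-- The Hardy space `L²₊(𝕋)` of the circle, modeled by the Hilbert space `ℓ²(ℕ, ℂ)` of
sequences of nonnegative Fourier (= Taylor) coefficients. -/
abbrev Hardy : Type := lp (fun _ : ℕ => ℂ) 2

/-- The Fourier coefficients of an element of the Hardy space. -/
def coeffs (f : Hardy) : ℕ → ℂ := fun n => f n

/-- Membership in the Sobolev space `Hˢ₊(𝕋)`, expressed on Fourier coefficients. -/
def InHs (s : ℝ) (u : ℕ → ℂ) : Prop :=
  Summable fun k : ℕ => ((1 : ℝ) + (k : ℝ) ^ 2) ^ s * ‖u k‖ ^ 2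

/-- The `Hˢ` norm, expressed on Fourier coefficients. -/
def hsNorm (s : ℝ) (u : ℕ → ℂ) : ℝ :=
  Real.sqrt (∑' k : ℕ, ((1 : ℝ) + (k : ℝ) ^ 2) ^ s * ‖u k‖ ^ 2)

/-- Membership in the Wiener algebra `W`. -/
def InW (u : ℕ → ℂ) : Prop := Summable fun k : ℕ => ‖u k‖

/-- The Wiener norm `‖u‖_W = Σ |û(k)|`. -/
def wienerNorm (u : ℕ → ℂ) : ℝ := ∑' k : ℕ, ‖u k‖

/-- The `L²` norm, expressed on Fourier coefficients. -/
def l2Norm (u : ℕ → ℂ) : ℝ := Real.sqrt (∑' k : ℕ, ‖u k‖ ^ 2)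

/-- The Hankel operator `H_u(h) = Π(u h̄)`, expressed on Fourier coefficients:
`(H_u h)^(n) = Σ_p û(n+p) conj(ĥ(p))`. -/
def hankel (u h : ℕ → ℂ) : ℕ → ℂ := fun n => ∑' p : ℕ, u (n + p) * conj (h p)

/-- The shifted Hankel operator `K_u = S* H_u`. -/
def shiftedHankel (u h : ℕ → ℂ) : ℕ → ℂ := fun n => hankel u h (n + 1)

/-- Fourier coefficients of the pointwise product `fg` of two holomorphic (Hardy class)
functions: the Cauchy product. -/
def mulCoeff (f g : ℕ → ℂ) : ℕ → ℂ := fun n => ∑ p ∈ Finset.range (n + 1), f p * g (n - p)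

/-- Fourier coefficients of `T_{a b̄}(h) = Π(a b̄ h)` for `a, b, h` in the Hardy class. -/
def toeplitzAB (a b h : ℕ → ℂ) : ℕ → ℂ :=
  fun n => ∑' q : ℕ, conj (b q) * mulCoeff a h (n + q)

/-- Fourier coefficients of `T_{ā}(h) = Π(ā h)` for `a, h` in the Hardy class. -/
def toeplitzConj (a h : ℕ → ℂ) : ℕ → ℂ := fun n => ∑' q : ℕ, conj (a q) * h (n + q)

/-- The Szegő nonlinearity `Π(|u|²u) = T_{u ū}(u)`. -/
def szegoNL (u : ℕ → ℂ) : ℕ → ℂ := toeplitzAB u u u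

/-- The operator `B_u = (i/2) H_u² - i T_{|u|²}` of the Lax pair. -/
def laxB (u h : ℕ → ℂ) : ℕ → ℂ := fun n =>
  Complex.I / 2 * hankel u (hankel u h) n - Complex.I * toeplitzAB u u h n

/-- The operator `C_u = (i/2) K_u² - i T_{|u|²}` of the Lax pair. -/
def laxC (u h : ℕ → ℂ) : ℕ → ℂ := fun n =>
  Complex.I / 2 * shiftedHankel u (shiftedHankel u h) n - Complex.I * toeplitzAB u u h n

/-- `u : ℝ → L²₊` is a (smooth in time, `Hˢ`-valued) solution of the cubic Szegő equation
`i ∂_t u = Π(|u|²u)`. -/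
def IsSzegoSolution (s : ℝ) (u : ℝ → Hardy) : Prop :=
  (∀ t, InHs s (coeffs (u t))) ∧ ContDiff ℝ (⊤ : ℕ∞) u ∧
    ∀ t n, HasDerivAt (fun τ : ℝ => coeffs (u τ) n) (-Complex.I * szegoNL (coeffs (u t)) n) t

/-- The Hankel operator with symbol `u` (composed with complex conjugation, which does not
change its range), as a linear map on finitely supported sequences. -/
def hankelLM (u : ℕ → ℂ) : (ℕ →₀ ℂ) →ₗ[ℂ] (ℕ → ℂ) :=
  Finsupp.lsum ℂ fun p => LinearMap.toSpanSingleton ℂ (ℕ → ℂ) fun n => u (n + p)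

/-- The rank of the Hankel operator `H_u`. -/
def hankelRank (u : ℕ → ℂ) : ℕ := Module.finrank ℂ (LinearMap.range (hankelLM u))

/-- The finite rank manifold `𝒱(d)`: `u` with `rk H_u = [(d+1)/2]` and `rk K_u = [d/2]`
(recall `K_u = H_{S*u}`). -/
def InV (d : ℕ) (u : ℕ → ℂ) : Prop :=
  InHs (1 / 2) u ∧ FiniteDimensional ℂ (LinearMap.range (hankelLM u)) ∧
    hankelRank u = (d + 1) / 2 ∧ hankelRank (fun n => u (n + 1)) = d / 2

/-- `w = w^y = (I + y H_u²)⁻¹(1)`, characterized by `(I + y H_u²) w = 1`. -/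
def IsResolventOne (y : ℝ) (u w : ℕ → ℂ) : Prop :=
  Memℓp w 2 ∧ ∀ n, w n + (y : ℂ) * hankel u (hankel u w) n = if n = 0 then 1 else 0

/-- The Hamiltonian vector field `X_{J^y}(u) = 2iy w^y H_u(w^y)` (a pointwise product of two
Hardy class functions), expressed on Fourier coefficients; `w` stands for `w^y`. -/
def XJ (y : ℝ) (u w : ℕ → ℂ) : ℕ → ℂ :=
  fun n => 2 * Complex.I * (y : ℂ) * mulCoeff w (hankel u w) n

/-- The operator `G_u^y(h) = -y w^y Π(conj(w^y) h) + y² (H_u w^y) Π(conj(H_u w^y) h)`;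
`w` stands for `w^y`. -/
def Gop (y : ℝ) (u w h : ℕ → ℂ) : ℕ → ℂ := fun n =>
  -(y : ℂ) * mulCoeff w (toeplitzConj w h) n
    + (y : ℂ) ^ 2 * mulCoeff (hankel u w) (toeplitzConj (hankel u w) h) n

/-- The operator `F_u^y(h) = G_u^y(h) - y² (h | H_u w^y) H_u w^y`; `w` stands for `w^y`. -/
def Fop (y : ℝ) (u w h : ℕ → ℂ) : ℕ → ℂ := fun n =>
  Gop y u w h n - (y : ℂ) ^ 2 * (∑' p : ℕ, h p * conj (hankel u w p)) * hankel u w n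

section FormTransport

open Set Filter Topology

section Forms

variable {E : Type*} [NormedAddCommGroup E] [NormedSpace ℂ E]

theorem opNorm_le_of_dense {D : Set E} (hD : Dense D) (q : E →L[ℂ] E →L[ℂ] ℂ) {M : ℝ}
    (hM : 0 ≤ M) (h : ∀ x ∈ D, ∀ z ∈ D, ‖q x z‖ ≤ M * ‖x‖ * ‖z‖) : ‖q‖ ≤ M := by
  refine q.opNorm_le_bound₂ hM fun x z => ?_
  have hcl : IsClosed {p : E × E | ‖q p.1 p.2‖ ≤ M * ‖p.1‖ * ‖p.2‖} :=
    isClosed_le (by fun_prop) (by fun_prop)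
  have hsub : D ×ˢ D ⊆ {p : E × E | ‖q p.1 p.2‖ ≤ M * ‖p.1‖ * ‖p.2‖} :=
    fun p hp => h p.1 hp.1 p.2 hp.2
  exact hcl.closure_subset_iff.2 hsub ((hD.prod hD) (x, z))

theorem form_ext_of_dense {D : Set E} (hD : Dense D) {q q' : E →L[ℂ] E →L[ℂ] ℂ}
    (h : ∀ x ∈ D, ∀ z ∈ D, q x z = q' x z) : q = q' := by
  have : ‖q - q'‖ ≤ 0 := opNorm_le_of_dense hD _ le_rfl fun x hx z hz => by
    simp [h x hx z hz]
  exact sub_eq_zero.1 (norm_le_zero_iff.1 this)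

/-- Weak convergence on a dense set of a bounded family of bilinear forms is joint
convergence along convergent arguments. -/
theorem tendsto_form_apply {D : Set E} (hD : Dense D) {ι : Type*} {l : Filter ι}
    {Φ : ι → E →L[ℂ] E →L[ℂ] ℂ} {Ψ : E →L[ℂ] E →L[ℂ] ℂ} {K : ℝ}
    (hK : ∀ᶠ i in l, ‖Φ i‖ ≤ K)
    (hΦ : ∀ x ∈ D, ∀ z ∈ D, Tendsto (fun i => Φ i x z) l (𝓝 (Ψ x z)))
    {f g : ι → E} {x z : E} (hf : Tendsto f l (𝓝 x)) (hg : Tendsto g l (𝓝 z)) :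
    Tendsto (fun i => Φ i (f i) (g i)) l (𝓝 (Ψ x z)) := by
  rcases l.eq_or_neBot with rfl | hl
  · exact tendsto_bot
  have hK0 : 0 ≤ K := by
    obtain ⟨i, hi⟩ := hK.exists
    exact (norm_nonneg (Φ i)).trans hi
  set L := K + ‖Ψ‖ with hL
  have hL0 : 0 ≤ L := by positivity
  rw [Metric.tendsto_nhds]
  intro ε hε
  have hcont : Continuous fun p : E × E =>
      L * ‖x - p.1‖ * ‖z‖ + L * ‖p.1‖ * ‖z - p.2‖ := by fun_prop
  have hopen : IsOpen {p : E × E |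
      L * ‖x - p.1‖ * ‖z‖ + L * ‖p.1‖ * ‖z - p.2‖ < ε / 2} :=
    isOpen_lt hcont continuous_const
  obtain ⟨⟨x', z'⟩, hp, hx', hz'⟩ := (hD.prod hD).inter_open_nonempty _ hopen
    ⟨(x, z), by simp [hε]⟩
  simp only [mem_ofPred_eq] at hp
  have h1 : Tendsto (fun i => K * ‖f i - x‖ * ‖g i‖ + K * ‖x‖ * ‖g i - z‖) l
      (𝓝 (K * ‖x - x‖ * ‖z‖ + K * ‖x‖ * ‖z - z‖)) :=
    ((tendsto_const_nhds.mul (hf.sub_const x).norm).mul hg.norm).add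
      (tendsto_const_nhds.mul (hg.sub_const z).norm)
  simp only [sub_self, norm_zero, mul_zero, zero_mul, add_zero] at h1
  have h1' := h1.eventually (gt_mem_nhds (show (0 : ℝ) < ε / 4 by linarith))
  have h2 := (Metric.tendsto_nhds.1 (hΦ x' hx' z' hz')) (ε / 4) (by linarith)
  filter_upwards [hK, h1', h2] with i hKi h1i h2i
  rw [dist_eq_norm] at h2i ⊢
  have e : Φ i (f i) (g i) - Ψ x z =
      (Φ i (f i - x) (g i) + Φ i x (g i - z)) + (Φ i - Ψ) (x - x') z
        + (Φ i - Ψ) x' (z - z') + (Φ i x' z' - Ψ x' z') := by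
    simp only [map_sub, sub_apply]
    ring
  have hΔ : ‖Φ i - Ψ‖ ≤ L := (norm_sub_le (Φ i) Ψ).trans (by linarith)
  have b : ∀ (q : E →L[ℂ] E →L[ℂ] ℂ) (C : ℝ), ‖q‖ ≤ C → ∀ v w : E, ‖q v w‖ ≤ C * ‖v‖ * ‖w‖ :=
    fun q C hq v w => (q.le_opNorm₂ v w).trans (by gcongr)
  rw [e]
  have n1 := norm_add_le (Φ i (f i - x) (g i) + Φ i x (g i - z) + (Φ i - Ψ) (x - x') z
    + (Φ i - Ψ) x' (z - z')) (Φ i x' z' - Ψ x' z')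
  have n2 := norm_add₄_le (a := Φ i (f i - x) (g i)) (b := Φ i x (g i - z))
    (c := (Φ i - Ψ) (x - x') z) (d := (Φ i - Ψ) x' (z - z'))
  have := b _ _ hKi (f i - x) (g i)
  have := b _ _ hKi x (g i - z)
  have := b _ _ hΔ (x - x') z
  have := b _ _ hΔ x' (z - z')
  linarith

end Forms

/-- A Lipschitz estimate that holds infinitesimally to the right of the points of a closed set
and across its gaps holds globally. -/
theorem norm_sub_le_of_closed_of_gaps {F : Type*} [NormedAddCommGroup F] {f : ℝ → F}
    {P : Set ℝ} {c r κ : ℝ} (hcr : c ≤ r) (hf : ContinuousOn f (Icc c r))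
    (hP : IsClosed (P ∩ Icc c r)) (hc : c ∈ P)
    (hacc : ∀ p ∈ P ∩ Ico c r, ∀ᶠ s in 𝓝[>] p, ‖f s - f p‖ ≤ κ * (s - p))
    (hgap : ∀ p ∈ P ∩ Ico c r, ∀ s ∈ Ioc p r, (∀ x ∈ Ioo p s, x ∉ P) →
      ‖f s - f p‖ ≤ κ * (s - p)) :
    ‖f r - f c‖ ≤ κ * (r - c) := by
  set S := {s ∈ P ∩ Icc c r | ‖f s - f c‖ ≤ κ * (s - c)} with hS
  have hScl : IsClosed S := by
    have hg : ContinuousOn (fun s => κ * (s - c) - ‖f s - f c‖) (P ∩ Icc c r) := by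
      have := hf.mono (inter_subset_right (s := P))
      fun_prop
    have := hg.preimage_isClosed_of_isClosed hP (isClosed_Ici (a := (0 : ℝ)))
    convert this using 1
    ext s
    simp [hS]
  have hScpt : IsCompact S := isCompact_Icc.of_isClosed_subset hScl fun s hs => hs.1.2
  obtain ⟨d, hdS, hd⟩ := hScpt.exists_isGreatest
    ⟨c, ⟨hc, left_mem_Icc.2 hcr⟩, by simp⟩
  have step : ∀ s, ‖f s - f d‖ ≤ κ * (s - d) → ‖f s - f c‖ ≤ κ * (s - c) := fun s hs => by
    have := norm_sub_le_norm_sub_add_norm_sub (f s) (f d) (f c)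
    have := hdS.2
    linarith
  rcases hdS.1.2.2.eq_or_lt with rfl | hdr
  · exact hdS.2
  have hdI : d ∈ P ∩ Ico c r := ⟨hdS.1.1, hdS.1.2.1, hdr⟩
  by_cases hne : ∃ s ∈ Ioc d r, s ∈ P ∧ ∀ x ∈ Ioo d s, x ∉ P
  · obtain ⟨s, hs, hsP, hx⟩ := hne
    have : s ∈ S := ⟨⟨hsP, hdS.1.2.1.trans hs.1.le, hs.2⟩, step s (hgap d hdI s hs hx)⟩
    exact absurd (hd this) (not_le.2 hs.1)
  by_cases hemp : ∀ x ∈ Ioo d r, x ∉ P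
  · exact step r (hgap d hdI r ⟨hdr, le_rfl⟩ hemp)
  exfalso
  push Not at hemp hne
  obtain ⟨e, he, hlip⟩ := (mem_nhdsGT_iff_exists_Ioo_subset).1 (hacc d hdI)
  -- every right neighbourhood of `d` meets `P`
  have key : ∃ x ∈ Ioo d (min e r), x ∈ P := by
    by_contra! hcon
    obtain ⟨x₀, hx₀, hx₀P⟩ := hemp
    have hm : d < min e r := lt_min he hdr
    have hle : min e r ≤ x₀ := by
      by_contra! h
      exact hcon x₀ ⟨hx₀.1, h⟩ hx₀P
    have hcpt : IsCompact (P ∩ Icc c r ∩ Icc (min e r) r) :=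
      isCompact_Icc.inter_left hP
    obtain ⟨s, hs, hleast⟩ := hcpt.exists_isLeast
      ⟨x₀, ⟨hx₀P, hdS.1.2.1.trans hx₀.1.le, hx₀.2.le⟩, hle, hx₀.2.le⟩
    obtain ⟨x, hx, hxP⟩ := hne s ⟨hm.trans_le hs.2.1, hs.2.2⟩ hs.1.1
    rcases lt_or_ge x (min e r) with h | h
    · exact hcon x ⟨hx.1, h⟩ hxP
    · exact absurd (hleast ⟨⟨hxP, hdS.1.2.1.trans hx.1.le, hx.2.le.trans hs.2.2⟩,
        h, hx.2.le.trans hs.2.2⟩) (not_le.2 hx.2)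
  obtain ⟨x, hx, hxP⟩ := key
  have hxr : x < r := hx.2.trans_le (min_le_right _ _)
  have : x ∈ S := ⟨⟨hxP, hdS.1.2.1.trans hx.1.le, hxr.le⟩,
    step x (hlip ⟨hx.1, hx.2.trans_le (min_le_left _ _)⟩)⟩
  exact absurd (hd this) (not_le.2 hx.1)

section Flow

variable {E : Type*} [NormedAddCommGroup E] [InnerProductSpace ℂ E]

/-- The pullback of a bilinear form along a bounded operator. -/
noncomputable def pullForm (q : E →L[ℂ] E →L[ℂ] ℂ) (T : E →L[ℂ] E) : E →L[ℂ] E →L[ℂ] ℂ :=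
  q.bilinearComp T T

@[simp]
theorem pullForm_apply (q : E →L[ℂ] E →L[ℂ] ℂ) (T : E →L[ℂ] E) (x z : E) :
    pullForm q T x z = q (T x) (T z) := rfl

theorem norm_pullForm_le (q : E →L[ℂ] E →L[ℂ] ℂ) {T : E →L[ℂ] E} (hT : ‖T‖ ≤ 1) :
    ‖pullForm q T‖ ≤ ‖q‖ := by
  refine (pullForm q T).opNorm_le_bound₂ (norm_nonneg q) fun x z => ?_
  have h : ∀ x, ‖T x‖ ≤ ‖x‖ := fun x => (T.le_of_opNorm_le hT x).trans (by simp)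
  exact (q.le_opNorm₂ _ _).trans (by gcongr <;> apply h)

theorem norm_pullForm_sub_le (q : E →L[ℂ] E →L[ℂ] ℂ) {S T : E →L[ℂ] E} (hS : ‖S‖ ≤ 1)
    (hT : ‖T‖ ≤ 1) : ‖pullForm q S - pullForm q T‖ ≤ 2 * ‖q‖ * ‖S - T‖ := by
  refine ContinuousLinearMap.opNorm_le_bound₂ _ (by positivity) fun x z => ?_
  have e : (pullForm q S - pullForm q T) x z = q ((S - T) x) (S z) + q (T x) ((S - T) z) := by
    simp
  have h1 : ‖q ((S - T) x) (S z)‖ ≤ ‖q‖ * (‖S - T‖ * ‖x‖) * (1 * ‖z‖) :=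
    (q.le_opNorm₂ _ _).trans (by
      gcongr
      · exact (S - T).le_opNorm x
      · exact S.le_of_opNorm_le hS z)
  have h2 : ‖q (T x) ((S - T) z)‖ ≤ ‖q‖ * (1 * ‖x‖) * (‖S - T‖ * ‖z‖) :=
    (q.le_opNorm₂ _ _).trans (by
      gcongr
      · exact T.le_of_opNorm_le hT x
      · exact (S - T).le_opNorm z)
  rw [e]
  refine (norm_add_le _ _).trans ((add_le_add h1 h2).trans (le_of_eq (by ring)))

variable [CompleteSpace E]

/-- A unitary flow `U' = B U` on `I` and a family of bounded bilinear forms `q` satisfying, weakly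
on a dense set, the transport equation which makes `q (U x) (U z)` formally constant. -/
structure FormFlow (I : Set ℝ) (D : Set E) (q : ℝ → E →L[ℂ] E →L[ℂ] ℂ)
    (U B : ℝ → E →L[ℂ] E) : Prop where
  isOpen : IsOpen I
  dense : Dense D
  adj_comp : ∀ t ∈ I, ContinuousLinearMap.adjoint (U t) ∘L U t = 1
  comp_adj : ∀ t ∈ I, U t ∘L ContinuousLinearMap.adjoint (U t) = 1
  hasDerivAt : ∀ t ∈ I, HasDerivAt U (B t ∘L U t) t
  form_hasDerivAt : ∀ t ∈ I, ∀ x ∈ D, ∀ z ∈ D,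
    HasDerivAt (fun τ => q τ x z) (-q t (B t x) z - q t x (B t z)) t

namespace FormFlow

open ContinuousLinearMap

variable {I : Set ℝ} {D : Set E} {q : ℝ → E →L[ℂ] E →L[ℂ] ℂ} {U B : ℝ → E →L[ℂ] E}

/-- The bilinear form transported back to the initial frame. -/
noncomputable def frame (q : ℝ → E →L[ℂ] E →L[ℂ] ℂ) (U : ℝ → E →L[ℂ] E) (t : ℝ) :
    E →L[ℂ] E →L[ℂ] ℂ :=
  pullForm (q t) (U t)

theorem norm_le_one (h : FormFlow I D q U B) {t : ℝ} (ht : t ∈ I) : ‖U t‖ ≤ 1 := by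
  refine ContinuousLinearMap.opNorm_le_bound _ zero_le_one fun x => ?_
  have := congrArg (fun T : E →L[ℂ] E => inner ℂ (T x) x) (h.adj_comp t ht)
  simp only [ContinuousLinearMap.comp_apply, ContinuousLinearMap.adjoint_inner_left,
    one_apply_eq_self, inner_self_eq_norm_sq_to_K] at this
  have h2 : ‖U t x‖ ^ 2 = ‖x‖ ^ 2 := by exact_mod_cast this
  rw [one_mul]
  exact (pow_le_pow_iff_left₀ (norm_nonneg _) (norm_nonneg _) two_ne_zero).1 h2.le

theorem norm_adjoint_le_one (h : FormFlow I D q U B) {t : ℝ} (ht : t ∈ I) :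
    ‖adjoint (U t)‖ ≤ 1 := by
  rw [LinearIsometryEquiv.norm_map]
  exact h.norm_le_one ht

theorem pullForm_frame (h : FormFlow I D q U B) {t : ℝ} (ht : t ∈ I) :
    pullForm (frame q U t) (adjoint (U t)) = q t := by
  ext x z
  have e : ∀ x, U t (adjoint (U t) x) = x := fun x =>
    congrArg (fun T : E →L[ℂ] E => T x) (h.comp_adj t ht)
  simp [frame, e]

theorem frame_eq_pullForm (h : FormFlow I D q U B) {t : ℝ} (ht : t ∈ I)
    {Q : E →L[ℂ] E →L[ℂ] ℂ} (hQ : q t = pullForm Q (adjoint (U t))) : frame q U t = Q := by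
  ext x z
  have e : ∀ x, adjoint (U t) (U t x) = x := fun x =>
    congrArg (fun T : E →L[ℂ] E => T x) (h.adj_comp t ht)
  simp [frame, hQ, e]

theorem continuousAt (h : FormFlow I D q U B) {t : ℝ} (ht : t ∈ I) : ContinuousAt U t :=
  (h.hasDerivAt t ht).continuousAt

theorem norm_frame_eq (h : FormFlow I D q U B) {t : ℝ} (ht : t ∈ I) :
    ‖frame q U t‖ = ‖q t‖ :=
  le_antisymm (norm_pullForm_le _ (h.norm_le_one ht))
    ((h.pullForm_frame ht) ▸ norm_pullForm_le _ (h.norm_adjoint_le_one ht))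

theorem norm_sub_le_of_frame_eq (h : FormFlow I D q U B) {s t : ℝ} (hs : s ∈ I) (ht : t ∈ I)
    (e : frame q U s = frame q U t) : ‖q s - q t‖ ≤ 2 * ‖q t‖ * ‖U s - U t‖ := by
  have := norm_pullForm_sub_le (frame q U t) (h.norm_adjoint_le_one hs) (h.norm_adjoint_le_one ht)
  rw [h.pullForm_frame ht, ← e, h.pullForm_frame hs, e, h.norm_frame_eq ht, ← map_sub,
    LinearIsometryEquiv.norm_map] at this
  exact this

/-- If the frame form is a constant near a filter converging to `c`, then it takes this value
at `c`. -/
theorem frame_eq_of_tendsto (h : FormFlow I D q U B) {c : ℝ} (hc : c ∈ I) {l : Filter ℝ} [l.NeBot]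
    (hl : l ≤ 𝓝 c) {Q : E →L[ℂ] E →L[ℂ] ℂ} (hQ : ∀ᶠ s in l, frame q U s = Q) :
    frame q U c = Q := by
  refine h.frame_eq_pullForm hc (form_ext_of_dense h.dense fun x hx z hz => ?_)
  have h1 : Tendsto (fun s => q s x z) l (𝓝 (q c x z)) :=
    ((h.form_hasDerivAt c hc x hx z hz).continuousAt.tendsto).mono_left hl
  have hU : ∀ x, Tendsto (fun s => adjoint (U s) x) l (𝓝 (adjoint (U c) x)) := fun x => by
    have h2 : Tendsto (fun s => adjoint (U s)) l (𝓝 (adjoint (U c))) :=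
      ((adjoint.continuous.tendsto _).comp (h.continuousAt hc).tendsto).mono_left hl
    exact ((ContinuousLinearMap.apply ℂ E x).continuous.tendsto _).comp h2
  have h2 : Tendsto (fun s => Q (adjoint (U s) x) (adjoint (U s) z)) l
      (𝓝 (Q (adjoint (U c) x) (adjoint (U c) z))) :=
    (Q.continuous₂.tendsto _).comp ((hU x).prodMk_nhds (hU z))
  refine tendsto_nhds_unique (h1.congr' ?_) h2
  filter_upwards [hQ, hl (h.isOpen.mem_nhds hc)] with s hs hsI
  rw [← h.pullForm_frame hsI, hs, pullForm_apply]

theorem frame_eq_of_gap (h : FormFlow I D q U B) {c r : ℝ} (hcr : c < r) (hI : Icc c r ⊆ I)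
    (hloc : ∀ s ∈ Ioo c r, ∀ᶠ s' in 𝓝 s, frame q U s' = frame q U s) :
    frame q U c = frame q U r := by
  obtain ⟨m, hm⟩ := nonempty_Ioo.2 hcr
  have hconst : ∀ s ∈ Ioo c r, frame q U s = frame q U m := by
    intro s hs
    ext x z
    have hd : ∀ s ∈ Ioo c r, HasDerivAt (fun s => frame q U s x z) 0 s := fun s hs =>
      (hasDerivAt_const s (frame q U s x z)).congr_of_eventuallyEq
        ((hloc s hs).mono fun s' hs' => congrArg (fun Q : E →L[ℂ] E →L[ℂ] ℂ => Q x z) hs')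
    exact isOpen_Ioo.is_const_of_deriv_eq_zero isPreconnected_Ioo
      (fun s hs => (hd s hs).differentiableAt.differentiableWithinAt)
      (fun s hs => (hd s hs).deriv) hs hm
  have h1 : frame q U c = frame q U m :=
    h.frame_eq_of_tendsto (hI ⟨le_rfl, hcr.le⟩) (l := 𝓝[>] c) nhdsWithin_le_nhds
      (by filter_upwards [Ioo_mem_nhdsGT hcr] with s hs using hconst s hs)
  have h2 : frame q U r = frame q U m :=
    h.frame_eq_of_tendsto (hI ⟨hcr.le, le_rfl⟩) (l := 𝓝[<] r) nhdsWithin_le_nhds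
      (by filter_upwards [Ioo_mem_nhdsLT hcr] with s hs using hconst s hs)
  rw [h1, h2]

/-- A right Lipschitz bound on the forms at `c` gives a vanishing right derivative of the
frame form. -/
theorem frame_hasDerivWithinAt (h : FormFlow I D q U B) {c K : ℝ} (hc : c ∈ I)
    (hK : ∀ᶠ s in 𝓝[>] c, ‖q s - q c‖ ≤ K * (s - c)) (x z : E) :
    HasDerivWithinAt (fun s => frame q U s x z) 0 (Ici c) c := by
  have hUd : ∀ x, HasDerivAt (fun s => U s x) (B c (U c x)) c := fun x =>
    (((ContinuousLinearMap.apply ℂ E x).restrictScalars ℝ).hasFDerivAt.comp_hasDerivAt c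
      (h.hasDerivAt c hc))
  have hUs : ∀ x, Tendsto (fun s => (s - c)⁻¹ • (U s x - U c x)) (𝓝[>] c) (𝓝 (B c (U c x))) :=
    fun x => by
    have := (hasDerivWithinAt_iff_tendsto_slope' self_notMem_Ioi).1
      ((hUd x).hasDerivWithinAt (s := Ioi c))
    exact this
  have hUc : ∀ x, Tendsto (fun s => U s x) (𝓝[>] c) (𝓝 (U c x)) := fun x =>
    ((hUd x).continuousAt.tendsto).mono_left nhdsWithin_le_nhds
  have hΦ := tendsto_form_apply h.dense (l := 𝓝[>] c) (K := K)
    (Φ := fun s => ((s - c)⁻¹ : ℂ) • (q s - q c))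
    (Ψ := -((q c).comp (B c)) - (q c).bilinearComp (ContinuousLinearMap.id ℂ E) (B c))
    (by
      filter_upwards [hK, self_mem_nhdsWithin] with s hs hcs
      have hpos : 0 < s - c := sub_pos.2 hcs
      refine (ContinuousLinearMap.opNorm_smul_le _ _).trans ?_
      rw [norm_inv, ← Complex.ofReal_sub, Complex.norm_real, Real.norm_of_nonneg hpos.le,
        inv_mul_le_iff₀ hpos, mul_comm]
      exact hs)
    (fun x hx z hz => by
      have := (hasDerivWithinAt_iff_tendsto_slope' self_notMem_Ioi).1
        ((h.form_hasDerivAt c hc x hx z hz).hasDerivWithinAt (s := Ioi c))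
      refine this.congr fun s => ?_
      simp [slope])
    (hUc x) (hUc z)
  have h2 : Tendsto (fun s => q c ((s - c)⁻¹ • (U s x - U c x)) (U s z)) (𝓝[>] c)
      (𝓝 (q c (B c (U c x)) (U c z))) :=
    ((q c).continuous₂.tendsto _).comp ((hUs x).prodMk_nhds (hUc z))
  have h3 : Tendsto (fun s => q c (U c x) ((s - c)⁻¹ • (U s z - U c z))) (𝓝[>] c)
      (𝓝 (q c (U c x) (B c (U c z)))) :=
    ((q c (U c x)).continuous.tendsto _).comp (hUs z)
  rw [← hasDerivWithinAt_Ioi_iff_Ici, hasDerivWithinAt_iff_tendsto_slope' self_notMem_Ioi]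
  have h4 := (hΦ.add h2).add h3
  have e0 : (-((q c).comp (B c)) - (q c).bilinearComp (ContinuousLinearMap.id ℂ E) (B c))
      (U c x) (U c z) + q c (B c (U c x)) (U c z) + q c (U c x) (B c (U c z)) = 0 := by
    simp
    ring
  rw [e0] at h4
  refine h4.congr fun s => ?_
  have e1 : ∀ v : E, (s - c)⁻¹ • v = ((s - c)⁻¹ : ℂ) • v := fun v => by
    rw [← Complex.ofReal_sub, ← Complex.ofReal_inv, Complex.coe_smul]
  simp [slope, frame, e1]
  ring

/-- The Baire category argument: no local boundedness of `q` or `B` is assumed, but both are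
controlled on a portion of the closed set where the frame form fails to be locally constant. -/
theorem frame_eventually_eq (h : FormFlow I D q U B) {t : ℝ} (ht : t ∈ I) :
    ∀ᶠ s in 𝓝 t, frame q U s = frame q U t := by
  by_contra hcon
  set O : Set ℝ := {t | ∀ᶠ s in 𝓝 t, frame q U s = frame q U t} with hO
  have hOo : IsOpen O := by
    refine isOpen_iff_eventually.2 fun s hs => ?_
    filter_upwards [eventually_eventually_nhds.2 hs, hs] with r hr hrs
    exact hr.mono fun r' hr' => hr'.trans hrs.symm
  set F : Set ℝ := I ∩ Oᶜ with hF
  have hFl : IsLocallyClosed F := h.isOpen.isLocallyClosed.inter hOo.isClosed_compl.isLocallyClosed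
  have : LocallyCompactSpace F := hFl.locallyCompactSpace
  have : Nonempty F := ⟨⟨t, ht, hcon⟩⟩
  have hqc : ∀ s ∈ I, ∀ x ∈ D, ∀ z ∈ D, ContinuousAt (fun τ => q τ x z) s :=
    fun s hs x hx z hz => (h.form_hasDerivAt s hs x hx z hz).continuousAt
  set P : ℕ → Set F := fun M => {c : F | (∀ x ∈ D, ∀ z ∈ D, ‖q c x z‖ ≤ M * ‖x‖ * ‖z‖) ∧
    ∀ r ∈ I, 1 ≤ |r - c| * (M + 1) ∨ ‖U r - U c‖ ≤ M * |r - c|} with hP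
  have hPcl : ∀ M, IsClosed (P M) := by
    intro M
    have hUc : Continuous fun c : F => U c := continuous_iff_continuousAt.2 fun c =>
      (h.continuousAt c.2.1).comp continuous_subtype_val.continuousAt
    refine IsClosed.and ?_ ?_
    · simp only [ofPred_forall]
      refine isClosed_iInter fun x => isClosed_iInter fun hx => isClosed_iInter fun z =>
        isClosed_iInter fun hz => isClosed_le ?_ continuous_const
      exact (continuous_iff_continuousAt.2 fun c : F =>
        (hqc c c.2.1 x hx z hz).comp continuous_subtype_val.continuousAt).norm
    · simp only [ofPred_forall]
      refine isClosed_iInter fun r => isClosed_iInter fun hr => IsClosed.union (s₁ := {c : F | 1 ≤ |r - c| * (M + 1)})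
        (s₂ := {c : F | ‖U r - U c‖ ≤ M * |r - c|}) ?_ ?_
      · exact isClosed_le continuous_const (by fun_prop)
      · exact isClosed_le (continuous_const.sub hUc).norm (by fun_prop)
  have hPu : ⋃ M, P M = univ := by
    refine eq_univ_of_forall fun c => mem_iUnion.2 ?_
    obtain ⟨C, hC⟩ := (h.hasDerivAt c c.2.1).isBigO_sub.bound
    obtain ⟨ε, hε, hball⟩ := Metric.eventually_nhds_iff.1 hC
    obtain ⟨M, hM⟩ := exists_nat_ge (max (max C ‖q c‖) ε⁻¹)
    have hM1 : C ≤ M := (le_max_left _ _).trans ((le_max_left _ _).trans hM)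
    have hM2 : ‖q c‖ ≤ M := (le_max_right _ _).trans ((le_max_left _ _).trans hM)
    have hM3 : ε⁻¹ ≤ M := (le_max_right _ _).trans hM
    refine ⟨M, fun x _ z _ => ((q c).le_opNorm₂ x z).trans (by gcongr), fun r _ => ?_⟩
    rcases le_or_gt 1 (|r - c| * (M + 1)) with h1 | h1
    · exact Or.inl h1
    · refine Or.inr ((hball ?_).trans ?_)
      · rw [Real.dist_eq]
        by_contra! hle
        have h2 : ε * ε⁻¹ ≤ |r - c| * (M + 1) := by gcongr; linarith
        rw [mul_inv_cancel₀ hε.ne'] at h2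
        linarith
      · rw [Real.norm_eq_abs]
        gcongr
  obtain ⟨M, p, hp⟩ := nonempty_interior_of_iUnion_of_closed hPcl hPu
  obtain ⟨V, hV, hVp⟩ := mem_nhds_subtype _ _ _ |>.1 (mem_interior_iff_mem_nhds.1 hp)
  obtain ⟨δ₀, hδ₀, hball⟩ := Metric.mem_nhds_iff.1
    (inter_mem hV (h.isOpen.mem_nhds p.2.1))
  set δ := min δ₀ (1 / (2 * ((M : ℝ) + 1))) with hδ
  have hδp : 0 < δ := lt_min hδ₀ (by positivity)
  have hδM : 2 * δ * ((M : ℝ) + 1) ≤ 1 := by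
    have : δ ≤ 1 / (2 * ((M : ℝ) + 1)) := min_le_right _ _
    rw [le_div_iff₀ (by positivity)] at this
    linarith
  set J := Ioo ((p : ℝ) - δ) (p + δ) with hJ
  have hpJ : (p : ℝ) ∈ J := ⟨by linarith, by linarith⟩
  have hJsub : J ⊆ V ∩ I := by
    rw [hJ, ← Real.ball_eq_Ioo]
    exact (Metric.ball_subset_ball (min_le_left _ _)).trans hball
  have hJI : J ⊆ I := fun s hs => (hJsub hs).2
  have hJcc : ∀ {c r}, c ∈ J → r ∈ J → Icc c r ⊆ J := fun hc hr s hs =>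
    ⟨hc.1.trans_le hs.1, hs.2.trans_lt hr.2⟩
  have hmemP : ∀ c ∈ J, ∀ hc : c ∈ F, (⟨c, hc⟩ : F) ∈ P M := fun c hcJ hc =>
    hVp (show (⟨c, hc⟩ : F) ∈ Subtype.val ⁻¹' V from (hJsub hcJ).1)
  have hqM : ∀ c ∈ J, c ∈ F → ‖q c‖ ≤ M := fun c hcJ hc =>
    opNorm_le_of_dense h.dense _ (by positivity) (hmemP c hcJ hc).1
  have hUM : ∀ c ∈ J, c ∈ F → ∀ r ∈ J, ‖U r - U c‖ ≤ M * |r - c| := by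
    intro c hcJ hc r hr
    refine ((hmemP c hcJ hc).2 r (hJI hr)).resolve_left (not_le.2 (lt_of_lt_of_le ?_ hδM))
    have : |r - c| < 2 * δ := by
      rw [abs_lt]
      constructor <;> linarith [hcJ.1, hcJ.2, hr.1, hr.2]
    gcongr
  have hJn : ∀ c ∈ J, J ∈ 𝓝 c := fun c hc => isOpen_Ioo.mem_nhds hc
  have hBM : ∀ c ∈ J, c ∈ F → ‖B c‖ ≤ M := by
    intro c hcJ hc
    have h1 : ‖B c ∘L U c‖ ≤ M := (h.hasDerivAt c hc.1).le_of_lip' (by positivity) (by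
      filter_upwards [hJn c hcJ] with r hr using hUM c hcJ hc r hr)
    have h2 : B c = (B c ∘L U c) ∘L adjoint (U c) := by
      rw [ContinuousLinearMap.comp_assoc, h.comp_adj c hc.1]
      rfl
    rw [h2]
    calc _ ≤ ‖B c ∘L U c‖ * ‖adjoint (U c)‖ := ContinuousLinearMap.opNorm_comp_le _ _
      _ ≤ M * 1 := by
        gcongr
        exact h.norm_adjoint_le_one hc.1
      _ = M := mul_one _
  have hOF : ∀ s ∈ J, s ∉ F → s ∈ O := fun s hs hsF => by
    by_contra hsO
    exact hsF ⟨hJI hs, hsO⟩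
  have hFcpt : ∀ {c r}, c ∈ J → r ∈ J → IsCompact (F ∩ Icc c r) := by
    intro c r hc hr
    have : F ∩ Icc c r = Oᶜ ∩ Icc c r := by
      ext s
      exact ⟨fun hs => ⟨hs.1.2, hs.2⟩, fun hs => ⟨⟨hJI (hJcc hc hr hs.2), hs.1⟩, hs.2⟩⟩
    rw [this]
    exact isCompact_Icc.inter_left hOo.isClosed_compl
  have hgap : ∀ {c r}, c ∈ J → r ∈ J → c < r → (∀ s ∈ Ioo c r, s ∉ F) →
      frame q U c = frame q U r := fun hc hr hcr hemp =>
    h.frame_eq_of_gap hcr ((hJcc hc hr).trans hJI) fun s hs =>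
      hOF s (hJcc hc hr (Ioo_subset_Icc_self hs)) (hemp s hs)
  have hqJ : ∀ s ∈ J, ‖q s‖ ≤ M := by
    intro s hs
    by_cases hsF : s ∈ F
    · exact hqM s hs hsF
    suffices ∃ c ∈ J, c ∈ F ∧ frame q U s = frame q U c by
      obtain ⟨c, hcJ, hc, e⟩ := this
      rw [← h.norm_frame_eq (hJI hs), e, h.norm_frame_eq (hJI hcJ)]
      exact hqM c hcJ hc
    rcases lt_or_ge s p with hsp | hsp
    · obtain ⟨c, hc, hleast⟩ := (hFcpt hs hpJ).exists_isLeast ⟨p, p.2, hsp.le, le_rfl⟩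
      have hsc : s < c := lt_of_le_of_ne hc.2.1 fun e => hsF (e ▸ hc.1)
      refine ⟨c, hJcc hs hpJ hc.2, hc.1, hgap hs (hJcc hs hpJ hc.2) hsc fun r hr hrF => ?_⟩
      exact absurd (hleast ⟨hrF, hr.1.le, hr.2.le.trans hc.2.2⟩) (not_le.2 hr.2)
    · obtain ⟨c, hc, hgreat⟩ := (hFcpt hpJ hs).exists_isGreatest ⟨p, p.2, le_rfl, hsp⟩
      have hsc : c < s := lt_of_le_of_ne hc.2.2 fun e => hsF (e ▸ hc.1)
      refine ⟨c, hJcc hpJ hs hc.2, hc.1, (hgap (hJcc hpJ hs hc.2) hs hsc fun r hr hrF => ?_).symm⟩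
      exact absurd (hgreat ⟨hrF, hc.2.1.trans hr.1.le, hr.2.le⟩) (not_le.2 hr.1)
  set K : ℝ := 2 * M * M + 1 with hK
  have hlip : ∀ c ∈ J, c ∈ F → ∀ r ∈ J, c ≤ r → ‖q r - q c‖ ≤ K * (r - c) := by
    intro c hcJ hc r hr hcr
    have hcr0 : 0 ≤ r - c := sub_nonneg.2 hcr
    refine opNorm_le_of_dense h.dense _ (by positivity) fun x hx z hz => ?_
    rcases eq_or_ne x 0 with rfl | hx0
    · simp
    rcases eq_or_ne z 0 with rfl | hz0
    · simp
    have hIcc := hJcc hcJ hr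
    have key := norm_sub_le_of_closed_of_gaps (f := fun s => q s x z) (P := F)
      (κ := K * ‖x‖ * ‖z‖) hcr
      (fun s hs => (hqc s (hJI (hIcc hs)) x hx z hz).continuousWithinAt)
      (hFcpt hcJ hr).isClosed hc
      (fun d hd => by
        have hdJ := hIcc (Ico_subset_Icc_self hd.2)
        have hB : ∀ x, ‖B d x‖ ≤ M * ‖x‖ := fun x => (B d).le_of_opNorm_le (hBM d hdJ hd.1) x
        have hbd : ‖-q d (B d x) z - q d x (B d z)‖ < K * ‖x‖ * ‖z‖ := by
          have h1 : ‖q d (B d x) z‖ ≤ M * (M * ‖x‖) * ‖z‖ := ((q d).le_opNorm₂ _ _).trans (by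
            gcongr
            · exact hqM d hdJ hd.1
            · exact hB x)
          have h2 : ‖q d x (B d z)‖ ≤ M * ‖x‖ * (M * ‖z‖) := ((q d).le_opNorm₂ _ _).trans (by
            gcongr
            · exact hqM d hdJ hd.1
            · exact hB z)
          have h3 := norm_sub_le (-q d (B d x) z) (q d x (B d z))
          rw [norm_neg] at h3
          have h4 : 0 < ‖x‖ * ‖z‖ := by positivity
          rw [hK]
          nlinarith
        have := ((h.form_hasDerivAt d (hJI hdJ) x hx z hz).hasDerivWithinAt
          (s := Ioi d)).limsup_norm_slope_le hbd
        filter_upwards [this, self_mem_nhdsWithin] with s hs hds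
        have hpos : 0 < s - d := sub_pos.2 hds
        rw [Real.norm_of_nonneg hpos.le, inv_mul_lt_iff₀ hpos] at hs
        linarith)
      (fun d hd s hs hemp => by
        have hdJ := hIcc (Ico_subset_Icc_self hd.2)
        have hsJ := hIcc ⟨hd.2.1.trans hs.1.le, hs.2⟩
        have h1 := h.norm_sub_le_of_frame_eq (hJI hsJ) (hJI hdJ) (hgap hdJ hsJ hs.1 hemp).symm
        have h2 := hUM d hdJ hd.1 s hsJ
        have hpos : 0 < s - d := sub_pos.2 hs.1
        rw [abs_of_pos hpos] at h2
        have h3 : ‖q s - q d‖ ≤ K * (s - d) := h1.trans (by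
          calc 2 * ‖q d‖ * ‖U s - U d‖ ≤ 2 * M * (M * (s - d)) := by
                gcongr
                exact hqM d hdJ hd.1
            _ ≤ K * (s - d) := by rw [hK]; nlinarith)
        calc ‖q s x z - q d x z‖ = ‖(q s - q d) x z‖ := by simp
          _ ≤ ‖q s - q d‖ * ‖x‖ * ‖z‖ := (q s - q d).le_opNorm₂ x z
          _ ≤ K * (s - d) * ‖x‖ * ‖z‖ := by gcongr
          _ = _ := by ring)
    calc ‖(q r - q c) x z‖ = ‖q r x z - q c x z‖ := by simp
      _ ≤ _ := key
      _ = _ := by ring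
  have hcontJ : ∀ x z, ∀ s ∈ J, ContinuousAt (fun s => frame q U s x z) s := by
    intro x z s hs
    have hUx : ∀ x, Tendsto (fun s => U s x) (𝓝 s) (𝓝 (U s x)) := fun x =>
      ((ContinuousLinearMap.apply ℂ E x).continuous.tendsto _).comp
        (h.continuousAt (hJI hs)).tendsto
    exact tendsto_form_apply h.dense (K := M)
      (by filter_upwards [hJn s hs] with r hr using hqJ r hr)
      (fun x hx z hz => hqc s (hJI hs) x hx z hz) (hUx x) (hUx z)
  have hder : ∀ x z, ∀ s ∈ J, HasDerivWithinAt (fun s => frame q U s x z) 0 (Ici s) s := by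
    intro x z s hs
    by_cases hsF : s ∈ F
    · refine h.frame_hasDerivWithinAt (K := K) hsF.1 ?_ x z
      filter_upwards [mem_nhdsWithin_of_mem_nhds (hJn s hs), self_mem_nhdsWithin] with r hr hsr
      exact hlip s hs hsF r hr (le_of_lt hsr)
    · exact ((hasDerivAt_const s (frame q U s x z)).congr_of_eventuallyEq
        ((hOF s hs hsF).mono fun s' hs' =>
          congrArg (fun Q : E →L[ℂ] E →L[ℂ] ℂ => Q x z) hs')).hasDerivWithinAt
  have hmono : ∀ c ∈ J, ∀ r ∈ J, c ≤ r → frame q U r = frame q U c := by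
    intro c hc r hr hcr
    ext x z
    exact constant_of_has_deriv_right_zero
      (fun s hs => (hcontJ x z s (hJcc hc hr hs)).continuousWithinAt)
      (fun s hs => hder x z s (hJcc hc hr (Ico_subset_Icc_self hs))) r ⟨hcr, le_rfl⟩
  refine p.2.2 ?_
  filter_upwards [hJn p hpJ] with s hs
  rcases le_total s p with hsp | hsp
  · exact (hmono s hs p hpJ hsp).symm
  · exact hmono p hpJ s hs hsp

theorem frame_eq (h : FormFlow I D q U B) (hI : Convex ℝ I) {s t : ℝ} (hs : s ∈ I) (ht : t ∈ I) :
    frame q U s = frame q U t := by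
  wlog hst : s ≤ t generalizing s t
  · exact (this ht hs (le_of_not_ge hst)).symm
  rcases hst.eq_or_lt with rfl | hlt
  · rfl
  have hsub : Icc s t ⊆ I := hI.ordConnected.out hs ht
  exact h.frame_eq_of_gap hlt hsub fun r hr =>
    h.frame_eventually_eq (hsub (Ioo_subset_Icc_self hr))

end FormFlow

end Flow
end FormTransport

section UnitaryFlow

open Set Filter Topology

variable {E : Type*} [NormedAddCommGroup E] [InnerProductSpace ℂ E] [CompleteSpace E]

theorem adjoint_comp_self_of_hasDerivAt {I : Set ℝ} (hI : IsOpen I) (hIc : Convex ℝ I)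
    (h0 : (0 : ℝ) ∈ I) {U B : ℝ → E →L[ℂ] E} (hU : ∀ t ∈ I, HasDerivAt U (B t ∘L U t) t)
    (hU0 : U 0 = 1) (hB : ∀ t ∈ I, ContinuousLinearMap.adjoint (B t) = -B t) {t : ℝ}
    (ht : t ∈ I) : ContinuousLinearMap.adjoint (U t) ∘L U t = 1 := by
  have hx : ∀ x, ∀ τ ∈ I, HasDerivAt (fun τ => U τ x) (B τ (U τ x)) τ := fun x τ hτ =>
    (((ContinuousLinearMap.apply ℂ E x).restrictScalars ℝ).hasFDerivAt.comp_hasDerivAt τ (hU τ hτ))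
  have hd : ∀ x z, ∀ τ ∈ I, HasDerivAt (fun τ => inner ℂ (U τ x) (U τ z)) 0 τ := by
    intro x z τ hτ
    have := (hx x τ hτ).inner ℂ (hx z τ hτ)
    rwa [← ContinuousLinearMap.adjoint_inner_left, hB τ hτ, neg_apply, inner_neg_left,
      neg_add_cancel] at this
  refine ContinuousLinearMap.ext fun z => ext_inner_left ℂ fun x => ?_
  have := hI.is_const_of_deriv_eq_zero hIc.isPreconnected
    (fun τ hτ => (hd x z τ hτ).differentiableAt.differentiableWithinAt)
    (fun τ hτ => (hd x z τ hτ).deriv) ht h0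
  rw [ContinuousLinearMap.comp_apply, ContinuousLinearMap.adjoint_inner_right, this, hU0]
  rfl

theorem self_comp_adjoint_of_isPreconnected {I : Set ℝ} (hI : IsOpen I) (hIc : IsPreconnected I)
    (h0 : (0 : ℝ) ∈ I) {U : ℝ → E →L[ℂ] E} (hU : ContinuousOn U I) (hU0 : U 0 = 1)
    (h : ∀ t ∈ I, ContinuousLinearMap.adjoint (U t) ∘L U t = 1) {t : ℝ} (ht : t ∈ I) :
    U t ∘L ContinuousLinearMap.adjoint (U t) = 1 := by
  have key : ∀ τ ∈ I, IsUnit (U τ) → U τ * ContinuousLinearMap.adjoint (U τ) = 1 := by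
    intro τ hτ hu
    obtain ⟨v, hv⟩ := hu
    have h1 : ContinuousLinearMap.adjoint (U τ) * U τ = 1 := h τ hτ
    rw [← hv] at h1 ⊢
    rw [Units.eq_inv_of_mul_eq_one_right h1]
    exact v.mul_inv
  have hsub : I ⊆ I ∩ U ⁻¹' {v | IsUnit v} := by
    refine hIc.subset_of_closure_inter_subset (hU.isOpen_inter_preimage hI Units.isOpen)
      ⟨0, h0, h0, by simp [hU0]⟩ ?_
    rintro τ ⟨hc, hτ⟩
    have hne := mem_closure_iff_nhdsWithin_neBot.1 hc
    have hcU : Tendsto U (𝓝[I ∩ U ⁻¹' {v | IsUnit v}] τ) (𝓝 (U τ)) :=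
      (hU τ hτ).mono inter_subset_left
    have hca := (ContinuousLinearMap.adjoint (𝕜 := ℂ) (E := E) (F := E)).continuous.tendsto (U τ)
    have h1 := hcU.mul (hca.comp hcU)
    have h2 : U τ * ContinuousLinearMap.adjoint (U τ) = 1 := by
      refine tendsto_nhds_unique h1 (tendsto_const_nhds.congr' ?_)
      filter_upwards [self_mem_nhdsWithin] with s hs
      exact (key s hs.1 hs.2).symm
    exact ⟨hτ, ⟨⟨U τ, _, h2, h τ hτ⟩, rfl⟩⟩
  exact key t ht (hsub ht).2

end UnitaryFlow

section HankelFlow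

open Filter Topology

open scoped Classical in
/-- The exponential `e^{ipx}`. -/
noncomputable def expBasis (p : ℕ) : Hardy := lp.single 2 p (1 : ℂ)

theorem expBasis_apply (p n : ℕ) : (expBasis p : ℕ → ℂ) n = if n = p then 1 else 0 := by
  classical
  rw [expBasis, lp.single_apply, Pi.single_apply]

theorem hasSum_expBasis (x : Hardy) : HasSum (fun p => x p • expBasis p) x := by
  classical
  convert lp.hasSum_single (E := fun _ : ℕ => ℂ) (p := 2) (by simp) x using 2 with p
  ext n
  rw [lp.coeFn_smul, Pi.smul_apply, expBasis_apply, lp.single_apply, Pi.single_apply]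
  simp [eq_comm]

theorem inner_expBasis_left (p : ℕ) (x : Hardy) : inner ℂ (expBasis p) x = x p := by
  classical
  rw [expBasis, lp.inner_single_left]
  simp

theorem dense_span_expBasis :
    Dense (Submodule.span ℂ (Set.range expBasis) : Set Hardy) := fun x =>
  mem_closure_of_tendsto (hasSum_expBasis x) (Eventually.of_forall fun _ =>
    Submodule.sum_mem _ fun p _ =>
      Submodule.smul_mem _ _ (Submodule.subset_span ⟨p, rfl⟩))

theorem hasSum_apply_expBasis {F : Type*} [NormedAddCommGroup F] [NormedSpace ℂ F]
    (L : Hardy →L[ℂ] F) (x : Hardy) : HasSum (fun p => x p • L (expBasis p)) (L x) := by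
  simpa using L.hasSum (hasSum_expBasis x)

theorem clm_ext_expBasis {F : Type*} [NormedAddCommGroup F] [NormedSpace ℂ F]
    {L L' : Hardy →L[ℂ] F} (h : ∀ p, L (expBasis p) = L' (expBasis p)) : L = L' := by
  ext x
  refine (hasSum_apply_expBasis L x).unique ?_
  simpa [h] using hasSum_apply_expBasis L' x

theorem sum_norm_sq_le (x : Hardy) (s : Finset ℕ) : ∑ p ∈ s, ‖x p‖ ^ 2 ≤ ‖x‖ ^ 2 := by
  have := lp.sum_rpow_le_norm_rpow (p := 2) (by norm_num) x s
  simpa using this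

theorem norm_mulCoeff_le (m : ℕ) (x z : Hardy) : ‖mulCoeff x z m‖ ≤ ‖x‖ * ‖z‖ := by
  rw [mulCoeff]
  refine (norm_sum_le _ _).trans ?_
  simp only [norm_mul]
  refine (Real.sum_mul_le_sqrt_mul_sqrt _ _ _).trans ?_
  gcongr
  · exact Real.sqrt_le_iff.2 ⟨norm_nonneg _, sum_norm_sq_le x _⟩
  · refine Real.sqrt_le_iff.2 ⟨norm_nonneg _, ?_⟩
    have := Finset.sum_range_reflect (fun p => ‖z p‖ ^ 2) (m + 1)
    simp only [add_tsub_cancel_right] at this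
    rw [this]
    exact sum_norm_sq_le z _

theorem mulCoeff_expBasis (m p n : ℕ) :
    mulCoeff (expBasis p) (expBasis n) m = if m = p + n then 1 else 0 := by
  rw [mulCoeff]
  simp only [expBasis_apply, ite_mul, one_mul, zero_mul, Finset.sum_ite_eq', Finset.mem_range]
  split_ifs <;> first | rfl | omega

theorem norm_mul_mulCoeff_le (g : ℕ → ℂ) (x z : Hardy) (m : ℕ) :
    ‖g m * mulCoeff x z m‖ ≤ ‖g m‖ * (‖x‖ * ‖z‖) := by
  rw [norm_mul]
  exact mul_le_mul_of_nonneg_left (norm_mulCoeff_le m x z) (norm_nonneg _)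

theorem summable_mul_mulCoeff {g : ℕ → ℂ} (hg : InW g) (x z : Hardy) :
    Summable fun m => g m * mulCoeff x z m :=
  Summable.of_norm_bounded (hg.mul_right _) (norm_mul_mulCoeff_le g x z)

/-- The bilinear Hankel form `Σ_m g(m) (x z)^(m)`. -/
noncomputable def hankelForm (g : ℕ → ℂ) (hg : InW g) : Hardy →L[ℂ] Hardy →L[ℂ] ℂ :=
  LinearMap.mkContinuous₂ (LinearMap.mk₂ ℂ (fun x z : Hardy => ∑' m, g m * mulCoeff x z m)
      (fun x x' z => by
        rw [← (summable_mul_mulCoeff hg x z).tsum_add (summable_mul_mulCoeff hg x' z)]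
        refine tsum_congr fun m => ?_
        simp only [mulCoeff, lp.coeFn_add, Pi.add_apply, add_mul, Finset.sum_add_distrib, mul_add])
      (fun c x z => by
        rw [smul_eq_mul, ← tsum_mul_left]
        refine tsum_congr fun m => ?_
        simp only [mulCoeff, lp.coeFn_smul, Pi.smul_apply, smul_eq_mul, Finset.mul_sum]
        exact Finset.sum_congr rfl fun _ _ => by ring)
      (fun x z z' => by
        rw [← (summable_mul_mulCoeff hg x z).tsum_add (summable_mul_mulCoeff hg x z')]
        refine tsum_congr fun m => ?_
        simp only [mulCoeff, lp.coeFn_add, Pi.add_apply, mul_add, Finset.sum_add_distrib])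
      (fun c x z => by
        rw [smul_eq_mul, ← tsum_mul_left]
        refine tsum_congr fun m => ?_
        simp only [mulCoeff, lp.coeFn_smul, Pi.smul_apply, smul_eq_mul, Finset.mul_sum]
        exact Finset.sum_congr rfl fun _ _ => by ring))
    (∑' m, ‖g m‖) fun x z => by
      rw [mul_assoc, ← tsum_mul_right]
      exact tsum_of_norm_bounded (hg.mul_right _).hasSum (norm_mul_mulCoeff_le g x z)

theorem hankelForm_expBasis {g : ℕ → ℂ} (hg : InW g) (p n : ℕ) :
    hankelForm g hg (expBasis p) (expBasis n) = g (p + n) := by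
  have : hankelForm g hg (expBasis p) (expBasis n)
      = ∑' m, g m * mulCoeff (expBasis p) (expBasis n) m := rfl
  rw [this, tsum_eq_single (p + n)]
  · rw [mulCoeff_expBasis, if_pos rfl, mul_one]
  · intro m hm
    rw [mulCoeff_expBasis, if_neg hm, mul_zero]

theorem inW_shift {u : ℕ → ℂ} (hu : InW u) (σ : ℕ) : InW fun m => conj (u (m + σ)) := by
  simpa [InW] using (summable_nat_add_iff σ).2 hu

/-- The bilinear form `(x, z) ↦ conj (S*^σ u | x z)` representing `S*^σ H_u`. -/
noncomputable def symbolForm (σ : ℕ) {u : ℕ → ℂ} (hu : InW u) : Hardy →L[ℂ] Hardy →L[ℂ] ℂ :=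
  hankelForm (fun m => conj (u (m + σ))) (inW_shift hu σ)

theorem symbolForm_expBasis {u : ℕ → ℂ} (hu : InW u) (σ p n : ℕ) :
    symbolForm σ hu (expBasis p) (expBasis n) = conj (u (p + n + σ)) :=
  hankelForm_expBasis (inW_shift hu σ) p n

theorem hasSum_symbolForm_left {u : ℕ → ℂ} (hu : InW u) (σ n : ℕ) (x : Hardy) :
    HasSum (fun p => x p * conj (u (p + n + σ))) (symbolForm σ hu x (expBasis n)) := by
  simpa [symbolForm_expBasis hu] using
    hasSum_apply_expBasis ((symbolForm σ hu).flip (expBasis n)) x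

theorem hasSum_symbolForm_right {u : ℕ → ℂ} (hu : InW u) (σ n : ℕ) (x : Hardy) :
    HasSum (fun p => x p * conj (u (p + n + σ))) (symbolForm σ hu (expBasis n) x) := by
  simpa [symbolForm_expBasis hu, add_comm n] using
    hasSum_apply_expBasis (symbolForm σ hu (expBasis n)) x

theorem symbolForm_conj {u : ℕ → ℂ} (hu : InW u) (σ n : ℕ) (x : Hardy) :
    symbolForm σ hu x (expBasis n) = conj (hankel u x (n + σ)) := by
  rw [← (hasSum_symbolForm_left hu σ n x).tsum_eq, hankel, Complex.conj_tsum]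
  refine tsum_congr fun p => ?_
  rw [map_mul, Complex.conj_conj, mul_comm, show p + n + σ = n + σ + p by ring]

theorem inW_of_inHs {s : ℝ} (hs : 1 < s) {u : ℕ → ℂ} (hu : InHs s u) : InW u := by
  have h1 : Summable fun k : ℕ => ((1 : ℝ) + (k : ℝ) ^ 2) ^ (-s) := by
    refine Summable.of_norm_bounded_eventually_nat
      (g := fun k : ℕ => (k : ℝ) ^ (-2 : ℝ)) (Real.summable_nat_rpow.2 (by norm_num)) ?_
    filter_upwards [eventually_ge_atTop 1] with k hk
    have hk' : (1 : ℝ) ≤ k := by exact_mod_cast hk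
    rw [Real.norm_of_nonneg (by positivity)]
    calc ((1 : ℝ) + (k : ℝ) ^ 2) ^ (-s) ≤ ((1 : ℝ) + (k : ℝ) ^ 2) ^ (-1 : ℝ) :=
          Real.rpow_le_rpow_of_exponent_le (by nlinarith) (by linarith)
      _ ≤ ((k : ℝ) ^ 2) ^ (-1 : ℝ) :=
          Real.rpow_le_rpow_of_nonpos (by positivity) (by linarith) (by norm_num)
      _ = (k : ℝ) ^ (-2 : ℝ) := by
          rw [← Real.rpow_natCast, ← Real.rpow_mul (by positivity)]
          norm_num
  refine Summable.of_nonneg_of_le (fun _ => norm_nonneg _) (fun k => ?_) (hu.add h1)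
  have hA : (0 : ℝ) < 1 + (k : ℝ) ^ 2 := by positivity
  have hB := Real.rpow_pos_of_pos hA s
  rw [Real.rpow_neg hA.le]
  set A := ((1 : ℝ) + (k : ℝ) ^ 2) ^ s
  have h2 : A * A⁻¹ = 1 := mul_inv_cancel₀ hB.ne'
  have h3 : 0 < A⁻¹ := inv_pos.2 hB
  have h4 : 0 ≤ A⁻¹ * (A * ‖u k‖ - 1) ^ 2 := by positivity
  have h5 : A⁻¹ * (A * ‖u k‖ - 1) ^ 2 = A * ‖u k‖ ^ 2 - 2 * ‖u k‖ + A⁻¹ := by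
    have : A⁻¹ * (A * ‖u k‖ - 1) ^ 2 =
      (A * A⁻¹) * (A * ‖u k‖ ^ 2) - 2 * (A * A⁻¹) * ‖u k‖ + A⁻¹ := by ring
    rw [this, h2]
    ring
  nlinarith [norm_nonneg (u k)]

theorem mulCoeff_comm (f g : ℕ → ℂ) (n : ℕ) : mulCoeff f g n = mulCoeff g f n := by
  unfold mulCoeff
  rw [← Finset.sum_range_reflect]
  refine Finset.sum_congr rfl fun j hj => ?_
  have := Finset.mem_range.1 hj
  rw [mul_comm, show n + 1 - 1 - j = n - j by omega, show n - (n - j) = j by omega]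

theorem toeplitzConj_expBasis (f : ℕ → ℂ) (p n : ℕ) :
    toeplitzConj f (coeffs (expBasis p)) n = if n ≤ p then conj (f (p - n)) else 0 := by
  unfold toeplitzConj coeffs
  split_ifs with h
  · rw [tsum_eq_single (p - n)]
    · rw [expBasis_apply, if_pos (by omega), mul_one]
    · intro q hq
      rw [expBasis_apply, if_neg (by omega), mul_zero]
  · simp only [expBasis_apply]
    rw [← tsum_zero (β := ℕ)]
    refine tsum_congr fun q => ?_
    rw [if_neg (by omega), mul_zero]

/-- The matrix of `T_f T_f̄`. -/
def toeplitzKernel (f : ℕ → ℂ) (n p : ℕ) : ℂ :=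
  ∑ j ∈ Finset.range (p + 1), if j ≤ n then f (n - j) * conj (f (p - j)) else 0

theorem mulCoeff_toeplitzConj_expBasis (f : ℕ → ℂ) (n p : ℕ) :
    mulCoeff f (toeplitzConj f (coeffs (expBasis p))) n = toeplitzKernel f n p := by
  rw [mulCoeff_comm, mulCoeff, toeplitzKernel]
  simp only [toeplitzConj_expBasis, ite_mul, zero_mul]
  rw [← Finset.sum_filter, ← Finset.sum_filter]
  refine Finset.sum_congr ?_ fun j _ => mul_comm _ _
  ext j
  simp only [Finset.mem_filter, Finset.mem_range]
  omega

theorem conj_toeplitzKernel (f : ℕ → ℂ) (n p : ℕ) :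
    conj (toeplitzKernel f p n) = toeplitzKernel f n p := by
  unfold toeplitzKernel
  rw [← Finset.sum_filter, ← Finset.sum_filter, map_sum]
  refine Finset.sum_congr ?_ fun j _ => ?_
  · ext j
    simp only [Finset.mem_filter, Finset.mem_range]
    omega
  · rw [map_mul, Complex.conj_conj, mul_comm]

theorem hasSum_toeplitzKernel {u f φ : ℕ → ℂ}
    (h : ∀ m, HasSum (fun i => f i * conj (u (i + m))) (conj (φ m))) (p N : ℕ) :
    HasSum (fun n => toeplitzKernel f n p * conj (u (n + N)))
      (conj (∑ j ∈ Finset.range (p + 1), f (p - j) * φ (N + j))) := by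
  unfold toeplitzKernel
  simp only [Finset.sum_mul, map_sum]
  refine hasSum_sum fun j _ => ?_
  have hinj : Function.Injective fun i : ℕ => i + j := add_left_injective j
  refine (hinj.hasSum_iff (α := ℂ) fun n hn => ?_).1 ?_
  · have : ¬ j ≤ n := fun hj => hn ⟨n - j, Nat.sub_add_cancel hj⟩
    rw [if_neg this, zero_mul]
  · rw [map_mul]
    refine Eq.mpr (congrArg (HasSum · _) (funext fun i => ?_))
      ((h (N + j)).mul_left (conj (f (p - j))))
    simp only [Function.comp_apply, Nat.add_sub_cancel, le_add_iff_nonneg_left, zero_le, if_true]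
    rw [show i + j + N = i + (N + j) by ring]
    ring

theorem mulCoeff_add_succ (f g : ℕ → ℂ) (n p : ℕ) :
    (∑ j ∈ Finset.range (p + 1), f (p - j) * g (n + 1 + j))
      + ∑ j ∈ Finset.range (n + 1), g (n - j) * f (p + 1 + j) = mulCoeff f g (n + p + 1) := by
  rw [mulCoeff, show n + p + 1 + 1 = (p + 1) + (n + 1) by ring, Finset.sum_range_add _ (p + 1),
    ← Finset.sum_range_reflect (fun x => f x * g (n + p + 1 - x)) (p + 1)]
  congr 1
  · refine Finset.sum_congr rfl fun j hj => ?_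
    have := Finset.mem_range.1 hj
    rw [show n + p + 1 - (p + 1 - 1 - j) = n + 1 + j by omega, Nat.add_sub_cancel]
  · refine Finset.sum_congr rfl fun j hj => ?_
    have := Finset.mem_range.1 hj
    rw [mul_comm]
    congr 2
    omega

theorem mulCoeff_add (f g : ℕ → ℂ) (n p : ℕ) :
    (∑ j ∈ Finset.range (p + 1), f (p - j) * g (n + j))
      + ∑ j ∈ Finset.range (n + 1), g (n - j) * f (p + j)
      = mulCoeff f g (n + p) + f p * g n := by
  cases n with
  | zero =>
    rw [mulCoeff, ← Finset.sum_range_reflect (fun x => f x * g (0 + p - x))]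
    simp only [zero_add, Finset.sum_range_one, add_zero, Nat.sub_self, mul_comm (g 0)]
    congr 1
    refine Finset.sum_congr rfl fun j hj => ?_
    have := Finset.mem_range.1 hj
    congr 2
    omega
  | succ n =>
    rw [Finset.sum_range_succ' (fun j => g (n + 1 - j) * f (p + j) : ℕ → ℂ), ← add_assoc,
      show n + 1 + p = n + p + 1 by ring, ← mulCoeff_add_succ]
    simp only [add_zero, Nat.sub_zero, mul_comm (g (n + 1))]
    congr 2
    refine Finset.sum_congr rfl fun j hj => ?_
    congr 2 <;> omega

theorem hasSum_conj_hankel {u : ℕ → ℂ} (hu : InW u) (x : Hardy) (m : ℕ) :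
    HasSum (fun i => x i * conj (u (i + m))) (conj (hankel u x m)) := by
  have := hasSum_symbolForm_left hu 0 m x
  rwa [symbolForm_conj] at this

theorem exists_hankel_eq {u : ℕ → ℂ} (hu : InW u) (x : Hardy) :
    ∃ z : Hardy, (z : ℕ → ℂ) = hankel u x := by
  refine ⟨(InnerProductSpace.toDual ℂ Hardy).symm (symbolForm 0 hu x), funext fun n => ?_⟩
  rw [← inner_expBasis_left, ← inner_conj_symm, InnerProductSpace.toDual_symm_apply,
    symbolForm_conj, Complex.conj_conj, add_zero]

theorem Gop_expBasis (y : ℝ) (u w : ℕ → ℂ) (p n : ℕ) :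
    Gop y u w (coeffs (expBasis p)) n
      = -(y : ℂ) * toeplitzKernel w n p + (y : ℂ) ^ 2 * toeplitzKernel (hankel u w) n p := by
  rw [Gop, mulCoeff_toeplitzConj_expBasis, mulCoeff_toeplitzConj_expBasis]

theorem Fop_expBasis (y : ℝ) (u w : ℕ → ℂ) (p n : ℕ) :
    Fop y u w (coeffs (expBasis p)) n = Gop y u w (coeffs (expBasis p)) n
      - (y : ℂ) ^ 2 * conj (hankel u w p) * hankel u w n := by
  rw [Fop, tsum_eq_single p]
  · rw [coeffs, expBasis_apply, if_pos rfl, one_mul]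
  · intro q hq
    rw [coeffs, expBasis_apply, if_neg hq, zero_mul]

theorem conj_Gop_expBasis (y : ℝ) (u w : ℕ → ℂ) (p n : ℕ) :
    conj (Gop y u w (coeffs (expBasis n)) p) = Gop y u w (coeffs (expBasis p)) n := by
  simp [Gop_expBasis, conj_toeplitzKernel]

theorem conj_Fop_expBasis (y : ℝ) (u w : ℕ → ℂ) (p n : ℕ) :
    conj (Fop y u w (coeffs (expBasis n)) p) = Fop y u w (coeffs (expBasis p)) n := by
  simp only [Fop_expBasis, map_sub, conj_Gop_expBasis, map_mul, map_pow, Complex.conj_conj,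
    Complex.conj_ofReal]
  ring

/-- The coefficient `(H_u G_u^y e^{ipx})^(N)`; `v` stands for `H_u w`. -/
def gopSymbol (y : ℝ) (w v : ℕ → ℂ) (p N : ℕ) : ℂ :=
  (y : ℂ) * ((if N = 0 then v p else 0) - ∑ j ∈ Finset.range (p + 1), v (p - j) * w (N + j))
    - (y : ℂ) * ∑ j ∈ Finset.range (p + 1), w (p - j) * v (N + j)

/-- The coefficient `(H_u F_u^y e^{ipx})^(N)`; `v` stands for `H_u w`. -/
def fopSymbol (y : ℝ) (w v : ℕ → ℂ) (p N : ℕ) : ℂ :=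
  gopSymbol y w v p N - (y : ℂ) * v p * ((if N = 0 then 1 else 0) - w N)

theorem gopSymbol_add (y : ℝ) (w v : ℕ → ℂ) (p n : ℕ) :
    gopSymbol y w v p (n + 1) + gopSymbol y w v n (p + 1)
      = -2 * (y : ℂ) * mulCoeff w v (p + n + 1) := by
  have h1 := mulCoeff_add_succ w v n p
  have h2 := mulCoeff_add_succ v w n p
  rw [mulCoeff_comm v w] at h2
  rw [gopSymbol, gopSymbol, if_neg (Nat.succ_ne_zero _), if_neg (Nat.succ_ne_zero _), add_comm p n]
  linear_combination -(y : ℂ) * h1 - (y : ℂ) * h2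

theorem fopSymbol_add (y : ℝ) (w v : ℕ → ℂ) (p n : ℕ) :
    fopSymbol y w v p n + fopSymbol y w v n p = -2 * (y : ℂ) * mulCoeff w v (p + n) := by
  have h1 := mulCoeff_add w v n p
  have h2 := mulCoeff_add v w n p
  rw [mulCoeff_comm v w] at h2
  have h3 : ∀ p n, (if n = 0 then v p else 0) = v p * if n = 0 then 1 else 0 := by simp
  rw [fopSymbol, fopSymbol, gopSymbol, gopSymbol, add_comm p n, h3 p n, h3 n p]
  linear_combination -(y : ℂ) * h1 - (y : ℂ) * h2

theorem hasSum_Gop {y : ℝ} {u w : ℕ → ℂ} (hu : InW u) (hw : IsResolventOne y u w) (p N : ℕ) :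
    HasSum (fun n => Gop y u w (coeffs (expBasis p)) n * conj (u (n + N)))
      (conj (gopSymbol y w (hankel u w) p N)) := by
  obtain ⟨v, hv⟩ := exists_hankel_eq hu ⟨w, hw.1⟩
  have hv' : (v : ℕ → ℂ) = hankel u w := hv
  have h1 := hasSum_toeplitzKernel (hasSum_conj_hankel hu ⟨w, hw.1⟩) p N
  have h2 := hasSum_toeplitzKernel (hasSum_conj_hankel hu v) p N
  have h3 := (h1.mul_left (-(y : ℂ))).add (h2.mul_left ((y : ℂ) ^ 2))
  rw [hv'] at h3
  have h4 : gopSymbol y w (hankel u w) p N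
      = -(y : ℂ) * (∑ j ∈ Finset.range (p + 1), w (p - j) * hankel u w (N + j))
        + (y : ℂ) ^ 2 * ∑ j ∈ Finset.range (p + 1),
          hankel u w (p - j) * hankel u (hankel u w) (N + j) := by
    have h5 : (if N = 0 then hankel u w p else 0)
        = ∑ j ∈ Finset.range (p + 1), hankel u w (p - j) * if N + j = 0 then 1 else 0 := by
      rw [Finset.sum_range_succ', Finset.sum_eq_zero]
      · simp
      · intro j _
        rw [if_neg (by omega), mul_zero]
    have h6 : ∀ m, (y : ℂ) * hankel u (hankel u w) m = (if m = 0 then 1 else 0) - w m :=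
      fun m => eq_sub_of_add_eq' (hw.2 m)
    rw [gopSymbol, h5, ← Finset.sum_sub_distrib]
    simp only [← mul_sub, ← h6, mul_left_comm (hankel u w _) (y : ℂ), ← Finset.mul_sum]
    ring
  rw [h4]
  simp only [map_add, map_mul, map_neg, map_pow, Complex.conj_ofReal]
  simp only [map_mul, map_sum] at h3 ⊢
  refine Eq.mpr (congrArg (HasSum · _) (funext fun n => ?_)) h3
  rw [Gop_expBasis]
  ring

theorem hasSum_Fop {y : ℝ} {u w : ℕ → ℂ} (hu : InW u) (hw : IsResolventOne y u w) (p N : ℕ) :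
    HasSum (fun n => Fop y u w (coeffs (expBasis p)) n * conj (u (n + N)))
      (conj (fopSymbol y w (hankel u w) p N)) := by
  obtain ⟨v, hv⟩ := exists_hankel_eq hu ⟨w, hw.1⟩
  have hv' : (v : ℕ → ℂ) = hankel u w := hv
  have h1 := (hasSum_conj_hankel hu v N).mul_left ((y : ℂ) ^ 2 * conj (hankel u w p))
  rw [hv'] at h1
  have h2 := (hasSum_Gop hu hw p N).sub h1
  have h3 : (y : ℂ) * hankel u (hankel u w) N = (if N = 0 then 1 else 0) - w N :=
    eq_sub_of_add_eq' (hw.2 N)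
  rw [fopSymbol, ← h3]
  refine Eq.mpr (congrArg₂ HasSum (funext fun n => ?_) ?_) h2
  · rw [Fop_expBasis]
    ring
  · simp only [map_sub, map_mul, Complex.conj_ofReal]
    ring

theorem adjoint_eq_neg_of_expBasis {ι : Type*} [Fintype ι] {a : ι → ℝ} {T : ι → ℕ → ℕ → ℂ}
    {B : Hardy →L[ℂ] Hardy}
    (hB : ∀ p n, B (expBasis p) n = ∑ k, (a k : ℂ) * (-Complex.I * T k p n))
    (hT : ∀ k p n, conj (T k n p) = T k p n) : ContinuousLinearMap.adjoint B = -B := by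
  refine clm_ext_expBasis fun p => ?_
  ext n
  rw [← inner_expBasis_left, ContinuousLinearMap.adjoint_inner_right, ← inner_conj_symm,
    inner_expBasis_left, hB, neg_apply, lp.coeFn_neg, Pi.neg_apply, hB, map_sum,
    ← Finset.sum_neg_distrib]
  refine Finset.sum_congr rfl fun k _ => ?_
  rw [map_mul, map_mul, hT, map_neg, Complex.conj_I, Complex.conj_ofReal]
  ring

theorem symbolForm_apply_expBasis_left {ι : Type*} [Fintype ι] {a : ι → ℝ}
    {T S : ι → ℕ → ℕ → ℂ} {B : Hardy →L[ℂ] Hardy} {u : ℕ → ℂ} (hu : InW u) (σ : ℕ)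
    (hB : ∀ p n, B (expBasis p) n = ∑ k, (a k : ℂ) * (-Complex.I * T k p n))
    (hS : ∀ k p N, HasSum (fun n => T k p n * conj (u (n + N))) (conj (S k p N))) (p n : ℕ) :
    symbolForm σ hu (B (expBasis p)) (expBasis n)
      = ∑ k, (a k : ℂ) * (-Complex.I * conj (S k p (n + σ))) := by
  refine (hasSum_symbolForm_left hu σ n (B (expBasis p))).unique ?_
  have := hasSum_sum (s := Finset.univ) fun k (_ : k ∈ Finset.univ) =>
    ((hS k p (n + σ)).mul_left (-Complex.I)).mul_left (a k : ℂ)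
  refine Eq.mpr (congrArg (HasSum · _) (funext fun i => ?_)) this
  rw [hB, Finset.sum_mul, add_assoc]
  exact Finset.sum_congr rfl fun k _ => by ring

theorem symbolForm_comm {u : ℕ → ℂ} (hu : InW u) (σ n : ℕ) (x : Hardy) :
    symbolForm σ hu (expBasis n) x = symbolForm σ hu x (expBasis n) :=
  (hasSum_symbolForm_right hu σ n x).unique (hasSum_symbolForm_left hu σ n x)

theorem hasDerivAt_form_of_span {s : Set Hardy} {q : ℝ → Hardy →L[ℂ] Hardy →L[ℂ] ℂ}
    {B : Hardy →L[ℂ] Hardy} {t : ℝ}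
    (h : ∀ x ∈ s, ∀ z ∈ s, HasDerivAt (fun τ => q τ x z) (-q t (B x) z - q t x (B z)) t) :
    ∀ x ∈ Submodule.span ℂ s, ∀ z ∈ Submodule.span ℂ s,
      HasDerivAt (fun τ => q τ x z) (-q t (B x) z - q t x (B z)) t := by
  intro x hx z hz
  induction hx, hz using Submodule.span_induction₂ with
  | mem_mem x z hx hz => exact h x hx z hz
  | zero_left z hz => simpa using hasDerivAt_const t (0 : ℂ)
  | zero_right x hx => simpa using hasDerivAt_const t (0 : ℂ)
  | add_left x x' z _ _ _ hx hx' =>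
    simp only [map_add, add_apply]
    exact (hx.add hx').congr_deriv (by ring)
  | add_right x z z' _ _ _ hz hz' =>
    simp only [map_add]
    exact (hz.add hz').congr_deriv (by ring)
  | smul_left c x z _ _ hx =>
    simp only [map_smul, smul_apply, smul_eq_mul]
    exact (hx.const_mul c).congr_deriv (by ring)
  | smul_right c x z _ _ hz =>
    simp only [map_smul, smul_eq_mul]
    exact (hz.const_mul c).congr_deriv (by ring)

/-- Lax pair integration for the (shifted) Hankel operators `S*^σ H_u`. -/
theorem hankel_conj_of_lax {ι : Type*} [Fintype ι] (σ : ℕ) {a : ι → ℝ} {I : Set ℝ}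
    (hI : IsOpen I) (hIc : Convex ℝ I) (h0 : (0 : ℝ) ∈ I) {u : ℝ → ℕ → ℂ}
    (hu : ∀ t ∈ I, InW (u t)) {T S : ℝ → ι → ℕ → ℕ → ℂ} {B U : ℝ → Hardy →L[ℂ] Hardy}
    (hB : ∀ t ∈ I, ∀ p n, B t (expBasis p) n = ∑ k, (a k : ℂ) * (-Complex.I * T t k p n))
    (hT : ∀ t ∈ I, ∀ k p n, conj (T t k n p) = T t k p n)
    (hS : ∀ t ∈ I, ∀ k p N, HasSum (fun n => T t k p n * conj (u t (n + N))) (conj (S t k p N)))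
    (hd : ∀ t ∈ I, ∀ p n, HasDerivAt (fun τ => u τ (p + n + σ))
      (∑ k, (a k : ℂ) * (-Complex.I * (S t k p (n + σ) + S t k n (p + σ)))) t)
    (hU : ∀ t ∈ I, HasDerivAt U (B t ∘L U t) t) (hU0 : U 0 = 1) {t : ℝ} (ht : t ∈ I) :
    (U t ∘L ContinuousLinearMap.adjoint (U t) = 1 ∧
      ContinuousLinearMap.adjoint (U t) ∘L U t = 1) ∧
    ∀ h v : Hardy,
      (∀ n, v n = hankel (u 0) (ContinuousLinearMap.adjoint (U t) h) (n + σ)) →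
      ∀ n, hankel (u t) h (n + σ) = U t v n := by
  classical
  have hadj : ∀ t ∈ I, ContinuousLinearMap.adjoint (U t) ∘L U t = 1 := fun t ht =>
    adjoint_comp_self_of_hasDerivAt hI hIc h0 hU hU0
      (fun τ hτ => adjoint_eq_neg_of_expBasis (hB τ hτ) (hT τ hτ)) ht
  have hcomp : ∀ t ∈ I, U t ∘L ContinuousLinearMap.adjoint (U t) = 1 := fun t ht =>
    self_comp_adjoint_of_isPreconnected hI hIc.isPreconnected h0
      (fun τ hτ => (hU τ hτ).continuousAt.continuousWithinAt) hU0 hadj ht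
  let q : ℝ → Hardy →L[ℂ] Hardy →L[ℂ] ℂ := fun t =>
    if h : InW (u t) then symbolForm σ h else 0
  have hq : ∀ t (ht : t ∈ I), q t = symbolForm σ (hu t ht) := fun t ht => dif_pos (hu t ht)
  have hflow : FormFlow I (Submodule.span ℂ (Set.range expBasis) : Set Hardy) q U B := by
    refine ⟨hI, dense_span_expBasis, hadj, hcomp, hU, fun t ht =>
      hasDerivAt_form_of_span ?_⟩
    rintro _ ⟨p, rfl⟩ _ ⟨n, rfl⟩
    have h1 : HasDerivAt (fun τ => conj (u τ (p + n + σ))) _ t := (hd t ht p n).star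
    refine HasDerivAt.congr_of_eventuallyEq (h1.congr_deriv ?_) ?_
    · rw [hq t ht, symbolForm_comm, symbolForm_apply_expBasis_left _ σ (hB t ht) (hS t ht),
        symbolForm_apply_expBasis_left _ σ (hB t ht) (hS t ht), ← Finset.sum_neg_distrib,
        ← Finset.sum_sub_distrib, ← starRingEnd_apply, map_sum]
      refine Finset.sum_congr rfl fun k _ => ?_
      simp only [map_mul, map_add, map_neg, Complex.conj_I, Complex.conj_ofReal]
      ring
    · filter_upwards [hI.mem_nhds ht] with τ hτ
      rw [hq τ hτ, symbolForm_expBasis]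
  refine ⟨⟨hcomp t ht, hadj t ht⟩, fun h v hv n => ?_⟩
  have hU0' : ContinuousLinearMap.adjoint (U 0) = 1 := by
    rw [hU0]
    exact star_one _
  have hframe : ∀ x z, q t x z
      = q 0 (ContinuousLinearMap.adjoint (U t) x) (ContinuousLinearMap.adjoint (U t) z) := by
    intro x z
    rw [← hflow.pullForm_frame ht, hflow.frame_eq hIc ht h0, FormFlow.frame, hU0]
    rfl
  set W := ContinuousLinearMap.adjoint (U t) with hW
  have h1 : conj (hankel (u t) h (n + σ)) = q 0 (W h) (W (expBasis n)) := by
    rw [← hframe, hq t ht, symbolForm_conj]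
  have h2 : q 0 (W h) (W (expBasis n)) = inner ℂ v (W (expBasis n)) := by
    rw [hq 0 h0]
    refine (hasSum_apply_expBasis _ _).unique ?_
    convert hasSum_apply_expBasis (innerSL ℂ v) (W (expBasis n)) using 2 with p
    · rw [symbolForm_conj, innerSL_apply_apply, ← inner_conj_symm, inner_expBasis_left, hv]
    · rw [innerSL_apply_apply]
  rw [h2, hW, ContinuousLinearMap.adjoint_inner_right, ← inner_conj_symm,
    inner_expBasis_left] at h1
  exact star_injective h1

end HankelFlow

/-- **Corollary 5.5**: along a solution of `u̇ = X_Ĵ(u)`, `Ĵ = Σ_k a_k J^{y_k}`, on a time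
interval `I ∋ 0`, the solutions `Û, V̂` of `Û' = B̂_u Û`, `V̂' = Ĉ_u V̂`, `Û(0) = V̂(0) = I`
(with `B̂_u = Σ_k a_k B_u^{y_k}`, `Ĉ_u = Σ_k a_k C_u^{y_k}`) are unitary and conjugate
`H_{u(t)}, K_{u(t)}` to `H_{u(0)}, K_{u(0)}` (conjugations expressed coefficientwise through an
auxiliary vector `v`). Here `w k t` denotes `w^{y_k}(t) = (I + y_k H_{u(t)}²)⁻¹(1)`. -/
theorem statement16 (s : ℝ) (hs : 1 < s) (m : ℕ) (y a : Fin m → ℝ) (hy : ∀ k, 0 < y k)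
    (I : Set ℝ) (hI : IsOpen I) (hIconv : Convex ℝ I) (h0I : (0 : ℝ) ∈ I)
    (u : ℝ → Hardy) (w : Fin m → ℝ → ℕ → ℂ)
    (hreg : ∀ t ∈ I, InHs s (coeffs (u t)))
    (hres : ∀ (k : Fin m), ∀ t ∈ I, IsResolventOne (y k) (coeffs (u t)) (w k t))
    (hsol : ∀ t ∈ I, ∀ n : ℕ, HasDerivAt (fun τ : ℝ => coeffs (u τ) n)
        (∑ k, (a k : ℂ) * XJ (y k) (coeffs (u t)) (w k t) n) t)
    (Bop Cop U V : ℝ → Hardy →L[ℂ] Hardy)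
    (hB : ∀ t ∈ I, ∀ (h : Hardy) (n : ℕ), coeffs (Bop t h) n
        = ∑ k, (a k : ℂ) * (-Complex.I * Fop (y k) (coeffs (u t)) (w k t) (coeffs h) n))
    (hC : ∀ t ∈ I, ∀ (h : Hardy) (n : ℕ), coeffs (Cop t h) n
        = ∑ k, (a k : ℂ) * (-Complex.I * Gop (y k) (coeffs (u t)) (w k t) (coeffs h) n))
    (hU : ∀ t ∈ I, HasDerivAt U (Bop t ∘L U t) t) (hU0 : U 0 = 1)
    (hV : ∀ t ∈ I, HasDerivAt V (Cop t ∘L V t) t) (hV0 : V 0 = 1)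
    (t : ℝ) (ht : t ∈ I) :
    (U t ∘L ContinuousLinearMap.adjoint (U t) = 1 ∧
      ContinuousLinearMap.adjoint (U t) ∘L U t = 1) ∧
    (V t ∘L ContinuousLinearMap.adjoint (V t) = 1 ∧
      ContinuousLinearMap.adjoint (V t) ∘L V t = 1) ∧
    (∀ h v : Hardy,
      (∀ n, coeffs v n
          = hankel (coeffs (u 0)) (coeffs (ContinuousLinearMap.adjoint (U t) h)) n) →
      ∀ n, hankel (coeffs (u t)) (coeffs h) n = coeffs (U t v) n) ∧
    (∀ h v : Hardy,
      (∀ n, coeffs v n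
          = shiftedHankel (coeffs (u 0)) (coeffs (ContinuousLinearMap.adjoint (V t) h)) n) →
      ∀ n, shiftedHankel (coeffs (u t)) (coeffs h) n = coeffs (V t v) n) := by
  have hW : ∀ t ∈ I, InW (coeffs (u t)) := fun t ht => inW_of_inHs hs (hreg t ht)
  obtain ⟨hUu, hUc⟩ := hankel_conj_of_lax (u := fun t => coeffs (u t)) 0 hI hIconv h0I hW
    (fun t ht p n => hB t ht (expBasis p) n) (fun t _ k p n => conj_Fop_expBasis _ _ _ p n)
    (fun t ht k p N => hasSum_Fop (hW t ht) (hres k t ht) p N)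
    (fun t ht p n => (hsol t ht (p + n)).congr_deriv <| Finset.sum_congr rfl fun k _ => by
      rw [XJ, add_zero, add_zero, fopSymbol_add]
      ring) hU hU0 ht
  obtain ⟨hVu, hVc⟩ := hankel_conj_of_lax (u := fun t => coeffs (u t)) 1 hI hIconv h0I hW
    (fun t ht p n => hC t ht (expBasis p) n) (fun t _ k p n => conj_Gop_expBasis _ _ _ p n)
    (fun t ht k p N => hasSum_Gop (hW t ht) (hres k t ht) p N)
    (fun t ht p n => (hsol t ht (p + n + 1)).congr_deriv <| Finset.sum_congr rfl fun k _ => by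
      rw [XJ, gopSymbol_add]
      ring) hV hV0 ht
  exact ⟨hUu, hVu, hUc, hVc⟩

end
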